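/- arXiv:0801.0857 — 2 statements merged into one kernel-verified Lean document; each statement's English description precedes it below -/
import Mathlib

section
/- Let m = 2n, let d be a positive integer with gcd(d, 2^n − 1) = 1, and let ν be the number of ordered pairs (x₁, x₂) ∈ F^* × F^* satisfying x₁ + x₂ + 1 = 0 and x₁^{d(2^n+1)} + x₂^{d(2^n+1)} + 1 = 0. Then Σ_{τ=0}^{2^n−2} (C_d(τ) + 1)³ = −2^{2m} + (ν + 3)·2^{n+m}. -/
open Finset

-- For `v` in the prime subfield `{0,1}` of `F`, `sgnF v` is the integer `(−1)^v`:
-- `1` if `v = 0` and `−1` if `v = 1`.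
open Classical in
noncomputable def sgnF {F : Type*} [Zero F] (v : F) : ℤ :=
  if v = 0 then 1 else -1

-- `trF j x = Σ_{i=0}^{j−1} x^(2^i)`.
def trF {F : Type*} [Field F] (j : ℕ) (x : F) : F :=
  ∑ i ∈ Finset.range j, x ^ 2 ^ i

-- The cross correlation `C_d(τ) = Σ_{t=0}^{2^m−2} (−1)^{s_t + u_{d(t+τ)}}` between the
-- `m`-sequence `s_t = tr_m(α^t)` of period `2^m−1` and the `d`-decimation of the
-- `m`-sequence `u_t = tr_n(β^t)` of period `2^n−1`, where `β = α^(2^n+1)`.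
noncomputable def crossCorr {F : Type*} [Field F] (m n d : ℕ) (α : F) (τ : ℕ) : ℤ :=
  ∑ t ∈ Finset.range (2 ^ m - 1),
    sgnF (trF m (α ^ t) + trF n ((α ^ (2 ^ n + 1)) ^ (d * (t + τ))))

section
variable {F : Type*} [Field F]

theorem sgnF_zero : sgnF (0 : F) = 1 := by simp [sgnF]

theorem sgnF_one : sgnF (1 : F) = -1 := by simp [sgnF]

theorem sgnF_add [CharP F 2] {a b : F} (ha : a = 0 ∨ a = 1) (hb : b = 0 ∨ b = 1) :
    sgnF (a + b) = sgnF a * sgnF b := by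
  rcases ha with rfl | rfl <;> rcases hb with rfl | rfl <;>
    simp [sgnF_zero, sgnF_one, CharTwo.add_self_eq_zero]

theorem trF_zero (j : ℕ) : trF j (0 : F) = 0 := by
  simp [trF]

theorem trF_add [CharP F 2] (j : ℕ) (x y : F) : trF j (x + y) = trF j x + trF j y := by
  simp only [trF, ← Finset.sum_add_distrib]
  exact Finset.sum_congr rfl fun i _ => add_pow_char_pow x y 2 i

theorem trF_eq_zero_or_one [CharP F 2] {j : ℕ} {x : F} (hx : x ^ 2 ^ j = x) :
    trF j x = 0 ∨ trF j x = 1 := by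
  have h : trF j x ^ 2 = trF j x := by
    have h1 : trF j x ^ 2 = ∑ i ∈ range j, x ^ 2 ^ (i + 1) := by
      rw [trF, sum_pow_char]
      exact Finset.sum_congr rfl fun i _ => by rw [← pow_mul, ← pow_succ]
    have h2 := Finset.sum_range_succ (fun i => x ^ 2 ^ i) j
    rw [Finset.sum_range_succ', hx, pow_zero, pow_one] at h2
    rw [h1]
    exact add_right_cancel h2
  have h' : trF j x * (trF j x - 1) = 0 := by linear_combination h
  rcases mul_eq_zero.1 h' with h0 | h0
  · exact Or.inl h0
  · exact Or.inr (sub_eq_zero.1 h0)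

theorem exists_trF_ne_zero {j : ℕ} (hj : 0 < j) (K : Finset F) (hK : K.card = 2 ^ j) :
    ∃ x ∈ K, trF j x ≠ 0 := by
  classical
  by_contra! h
  obtain ⟨k, rfl⟩ : ∃ k, j = k + 1 := ⟨j - 1, by omega⟩
  let p : Polynomial F := ∑ i ∈ range (k + 1), Polynomial.X ^ 2 ^ i
  have hp : p.coeff 1 = 1 := by
    simp only [p, Polynomial.finsetSum_coeff, Polynomial.coeff_X_pow]
    rw [Finset.sum_eq_single 0]
    · simp
    · intro i _ hi
      rw [if_neg]
      exact (Nat.one_lt_two_pow hi).ne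
    · simp
  have hp0 : p ≠ 0 := by
    rintro h0
    rw [h0] at hp
    simp at hp
  have hdeg : p.natDegree ≤ 2 ^ k := by
    refine Polynomial.natDegree_sum_le_of_forall_le _ _ fun i hi => ?_
    rw [Polynomial.natDegree_X_pow]
    exact Nat.pow_le_pow_right (by norm_num) (by have := Finset.mem_range.1 hi; omega)
  have hsub : K ⊆ p.roots.toFinset := by
    intro x hx
    rw [Multiset.mem_toFinset, Polynomial.mem_roots hp0, Polynomial.IsRoot]
    have := h x hx
    simpa [p, trF, Polynomial.eval_finsetSum] using this
  have h1 := (Finset.card_le_card hsub).trans (p.roots.toFinset_card_le.trans p.card_roots')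
  have h2 : 0 < 2 ^ k := by positivity
  rw [hK, pow_succ] at h1
  omega

theorem sum_sgnF_trF_eq_zero [CharP F 2] {j : ℕ} (hj : 0 < j) (K : Finset F)
    (hK : K.card = 2 ^ j) (hpow : ∀ x ∈ K, x ^ 2 ^ j = x)
    (hadd : ∀ x ∈ K, ∀ y ∈ K, x + y ∈ K) :
    ∑ x ∈ K, sgnF (trF j x) = 0 := by
  obtain ⟨z, hz, hz0⟩ := exists_trF_ne_zero hj K hK
  have hz1 := (trF_eq_zero_or_one (hpow z hz)).resolve_left hz0
  have h : ∑ x ∈ K, sgnF (trF j x) = ∑ x ∈ K, -sgnF (trF j x) := by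
    refine Finset.sum_nbij' (· + z) (· + z) (fun x hx => hadd x hx z hz)
      (fun x hx => hadd x hx z hz) ?_ ?_ ?_
    · intro x _
      simp [add_assoc, CharTwo.add_self_eq_zero]
    · intro x _
      simp [add_assoc, CharTwo.add_self_eq_zero]
    · intro x hx
      rw [trF_add, sgnF_add (trF_eq_zero_or_one (hpow x hx)) (Or.inr hz1), hz1, sgnF_one]
      ring
  rw [Finset.sum_neg_distrib] at h
  omega

theorem sum_range_orderOf_pow_mul [DecidableEq F] {G : Type*} [AddCommMonoid G]
    {K : Finset F} {γ z : F}
    (h0 : (0 : F) ∈ K) (hmul : ∀ x ∈ K, ∀ y ∈ K, x * y ∈ K) (hγ : γ ∈ K) (hz : z ∈ K)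
    (hz0 : z ≠ 0) (hγ0 : γ ≠ 0) (hord : orderOf γ = K.card - 1) (g : F → G) :
    ∑ t ∈ range (K.card - 1), g (γ ^ t * z) = ∑ x ∈ K.erase 0, g x := by
  have hinj : Set.InjOn (fun t => γ ^ t * z) (range (K.card - 1)) := by
    intro a ha b hb hab
    rw [Finset.coe_range, Set.mem_Iio, ← hord] at ha hb
    exact pow_injOn_Iio_orderOf ha hb (mul_right_cancel₀ hz0 hab)
  have hmem : ∀ t : ℕ, γ ^ t * z ∈ K := by
    intro t
    induction t with
    | zero => simpa using hz
    | succ t ih =>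
      rw [pow_succ', mul_assoc]
      exact hmul _ hγ _ ih
  have himage : (range (K.card - 1)).image (fun t => γ ^ t * z) = K.erase 0 := by
    refine Finset.eq_of_subset_of_card_le ?_ ?_
    · intro x hx
      obtain ⟨t, -, rfl⟩ := Finset.mem_image.1 hx
      exact Finset.mem_erase.2 ⟨mul_ne_zero (pow_ne_zero _ hγ0) hz0, hmem t⟩
    · rw [Finset.card_image_of_injOn hinj, Finset.card_range, Finset.card_erase_of_mem h0]
  rw [← himage, Finset.sum_image hinj]

section
variable [Fintype F]

theorem card_filter_pow_eq_one [DecidableEq F] {N : ℕ} (hN : N ≠ 0) :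
    #{x : F | x ^ N = 1} = (Fintype.card F - 1).gcd N := by
  have h := IsCyclic.card_powMonoidHom_ker (G := Fˣ) N
  rw [Nat.card_units] at h
  rw [← Nat.card_eq_fintype_card, ← h,
    ← Nat.subtype_card (p := fun x : F => x ^ N = 1) {x | x ^ N = 1} (by simp)]
  symm
  refine Nat.card_congr ⟨fun u => ⟨u.1, by simpa using congrArg Units.val u.2⟩,
    fun x => ⟨Units.mk0 x.1 ?_, ?_⟩, ?_, ?_⟩
  · rintro h0
    have := x.2
    simp [h0, hN] at this
  · ext
    simpa using x.2
  · intro u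
    ext
    rfl
  · intro x
    rfl

theorem card_filter_pow_eq_pow [DecidableEq F] {N : ℕ} (hN : N ≠ 0) {y : F} (hy : y ≠ 0) :
    #{x : F | x ^ N = y ^ N} = (Fintype.card F - 1).gcd N := by
  rw [← card_filter_pow_eq_one hN]
  refine Finset.card_nbij' (· / y) (· * y) ?_ ?_ ?_ ?_
  · intro x hx
    simp_all [div_pow]
  · intro x hx
    simp_all [mul_pow]
  · intro x _
    simp [hy]
  · intro x _
    simp [hy]

theorem card_filter_pow_eq_self [DecidableEq F] {q : ℕ} (hq : 1 < q) (hF : Fintype.card F = q ^ 2) :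
    #{x : F | x ^ q = x} = q := by
  have h : (univ.filter fun x : F => x ^ q = x) =
      insert 0 (univ.filter fun x : F => x ^ (q - 1) = 1) := by
    obtain ⟨k, rfl⟩ : ∃ k, q = k + 1 := ⟨q - 1, by omega⟩
    ext x
    by_cases hx : x = 0
    · simp [hx]
    · simp [hx, pow_succ]
  rw [h, Finset.card_insert_of_notMem, card_filter_pow_eq_one, hF, Nat.gcd_eq_right]
  · omega
  · exact ⟨q + 1, by zify [Nat.one_le_pow 2 q (by omega), hq.le]; ring⟩
  · omega
  · simp [show q - 1 ≠ 0 by omega]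

theorem exists_pow_eq_of_pow_eq_one {N M : ℕ}
    (hNM : (Fintype.card F - 1).gcd N * M = Fintype.card F - 1)
    {u : F} (hu : u ^ M = 1) : ∃ x : F, x ≠ 0 ∧ x ^ N = u := by
  have hF : 0 < Fintype.card F - 1 := by
    have := Fintype.one_lt_card (α := F)
    omega
  have hM : M ≠ 0 := by
    rintro rfl
    omega
  have hu0 : u ≠ 0 := by
    rintro rfl
    simp [hM] at hu
  have hle : (powMonoidHom N : Fˣ →* Fˣ).range ≤ (powMonoidHom M : Fˣ →* Fˣ).ker := by
    rintro _ ⟨x, rfl⟩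
    rw [MonoidHom.mem_ker, powMonoidHom_apply, powMonoidHom_apply, ← pow_mul]
    have hdvd : Fintype.card F - 1 ∣ N * M := by
      rw [← hNM]
      exact Nat.mul_dvd_mul_right (Nat.gcd_dvd_right _ _) M
    obtain ⟨k, hk⟩ := hdvd
    rw [hk, pow_mul, ← Nat.card_eq_fintype_card, ← Nat.card_units, pow_card_eq_one', one_pow]
  have heq := Subgroup.eq_of_le_of_card_ge hle (by
    rw [IsCyclic.card_powMonoidHom_ker, IsCyclic.card_powMonoidHom_range, Nat.card_units,
      Nat.card_eq_fintype_card]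
    have h1 : (Fintype.card F - 1) / (Fintype.card F - 1).gcd N = M := by
      refine Nat.div_eq_of_eq_mul_right (Nat.gcd_pos_of_pos_left _ hF) hNM.symm
    rw [h1]
    exact Nat.gcd_le_right _ (by omega))
  have hmem : Units.mk0 u hu0 ∈ (powMonoidHom M : Fˣ →* Fˣ).ker := by
    rw [MonoidHom.mem_ker]
    ext
    simpa using hu
  rw [← heq] at hmem
  obtain ⟨x, hx⟩ := hmem
  exact ⟨x, x.ne_zero, by simpa using congrArg Units.val hx⟩

theorem sq_sub_one_gcd {q d : ℕ} (hq : 1 < q) (hd : d.gcd (q - 1) = 1) :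
    (q ^ 2 - 1).gcd (d * (q + 1)) = q + 1 := by
  have : q ^ 2 - 1 = (q - 1) * (q + 1) := by
    zify [Nat.one_le_pow 2 q (by omega), hq.le]; ring
  rw [this, Nat.gcd_mul_right, Nat.gcd_comm, hd, one_mul]

theorem card_filter_pow_eq [DecidableEq F] {q d : ℕ} (hq : 1 < q) (hd0 : d ≠ 0)
    (hd : d.gcd (q - 1) = 1) (hF : Fintype.card F = q ^ 2) {u : F} (hu : u ^ q = u) :
    #{x : F | x ^ (d * (q + 1)) = u} = if u = 0 then 1 else q + 1 := by
  split_ifs with h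
  · subst h
    rw [Finset.card_eq_one]
    refine ⟨0, ?_⟩
    ext x
    simp [hd0]
  · have hgcd := sq_sub_one_gcd hq hd
    obtain ⟨x, hx, rfl⟩ := exists_pow_eq_of_pow_eq_one (N := d * (q + 1))
      (M := q - 1) (u := u)
      (by
        rw [hF, hgcd]
        zify [Nat.one_le_pow 2 q (by omega), hq.le]; ring)
      (by
        have : u ^ (q - 1) * u = 1 * u := by rw [← pow_succ, Nat.sub_add_cancel hq.le, hu, one_mul]
        exact mul_right_cancel₀ h this)
    rw [card_filter_pow_eq_pow (by positivity) hx, hF, hgcd]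

theorem pow_mul_succ_pow {q : ℕ} (hF : Fintype.card F = q ^ 2) (d : ℕ) (x : F) :
    (x ^ (d * (q + 1))) ^ q = x ^ (d * (q + 1)) := by
  have h : x ^ (q * q) = x := by
    rw [← sq, ← hF, FiniteField.pow_card]
  rw [mul_comm d, pow_mul, pow_right_comm]
  congr 1
  rw [← pow_mul, add_mul, one_mul, pow_add, h, pow_succ, mul_comm]

theorem card_pow_triple_sum_eq_zero [DecidableEq F] [CharP F 2] {q d : ℕ} (hq : 1 < q)
    (hd0 : d ≠ 0) (hd : d.gcd (q - 1) = 1) (hF : Fintype.card F = q ^ 2)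
    (hq2 : ∀ x y : F, (x + y) ^ q = x ^ q + y ^ q) :
    (#{x : F × F × F | x.1 ^ (d * (q + 1)) + x.2.1 ^ (d * (q + 1)) + x.2.2 ^ (d * (q + 1)) = 0} : ℤ)
      = (q + 1) * q ^ 4 - q * (1 + (q ^ 2 - 1) * (q + 1)) := by
  set f : F → F := fun x => x ^ (d * (q + 1)) with hf
  have hfpow : ∀ x, f x ^ q = f x := pow_mul_succ_pow hF d
  have hf0 : ∀ x, f x = 0 ↔ x = 0 := fun x => by simp [hf, hd0]
  have hfib : ∀ u : F, u ^ q = u →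
      ∑ x, (if f x = u then (1 : ℤ) else 0) = (q + 1) - q * if u = 0 then 1 else 0 := by
    intro u hu
    have h := card_filter_pow_eq hq hd0 hd hF hu
    rw [Finset.sum_boole, h]
    split_ifs <;> simp
  have hz : ∑ x : F, (if x = 0 then (1 : ℤ) else 0) = 1 := by simp
  have hF' : (Fintype.card F : ℤ) = q ^ 2 := by exact_mod_cast hF
  have e1 : ∀ a b c : F, a + b + c = 0 ↔ c = a + b := fun a b c => by
    rw [CharTwo.add_eq_zero, eq_comm]
  have e2 : ∀ a b : F, a + b = 0 ↔ b = a := fun a b => by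
    rw [CharTwo.add_eq_zero, eq_comm]
  rw [Finset.card_filter]
  push_cast
  simp only [Fintype.sum_prod_type]
  change ∑ a, ∑ b, ∑ c, (if f a + f b + f c = 0 then (1 : ℤ) else 0) = _
  simp_rw [e1]
  have h1 : ∀ a b, ∑ c, (if f c = f a + f b then (1 : ℤ) else 0) =
      (q + 1) - q * if f b = f a then 1 else 0 := fun a b => by
    rw [hfib _ (by rw [hq2, hfpow, hfpow])]
    simp only [e2]
  simp_rw [h1, Finset.sum_sub_distrib, ← Finset.mul_sum, hfib _ (hfpow _), Finset.sum_sub_distrib,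
    ← Finset.mul_sum, hf0, hz, Finset.sum_const, Finset.card_univ, nsmul_eq_mul, hF']
  ring

theorem card_pow_pair_sum_eq_zero [DecidableEq F] [CharP F 2] {N : ℕ} (hN : N ≠ 0) :
    (#{x : F × F × F | x.1 ^ N + x.2.1 ^ N + x.2.2 ^ N = 0 ∧ x.1 + x.2.1 + x.2.2 = 0} : ℤ)
      = Fintype.card F + (Fintype.card F - 1) *
        ((Nat.card {p : F × F | p.1 ≠ 0 ∧ p.2 ≠ 0 ∧ p.1 + p.2 + 1 = 0 ∧
            p.1 ^ N + p.2 ^ N + 1 = 0} : ℤ) + 2) := by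
  have hstep : ∀ c : F, c ≠ 0 →
      #{p : F × F | p.1 ^ N + p.2 ^ N + c ^ N = 0 ∧ p.1 + p.2 + c = 0} =
      #{p : F × F | p.1 ^ N + p.2 ^ N + 1 = 0 ∧ p.1 + p.2 + 1 = 0} := by
    intro c hc
    have hcN := pow_ne_zero N hc
    refine Finset.card_nbij' (fun p => (p.1 / c, p.2 / c)) (fun p => (p.1 * c, p.2 * c)) ?_ ?_ ?_ ?_
    · rintro ⟨a, b⟩ h
      simp only [coe_filter, mem_univ, true_and, Set.mem_ofPred_eq] at h ⊢
      refine ⟨?_, ?_⟩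
      · rw [div_pow, div_pow, ← div_self hcN, ← add_div, ← add_div, h.1, zero_div]
      · rw [← div_self hc, ← add_div, ← add_div, h.2, zero_div]
    · rintro ⟨a, b⟩ h
      simp only [coe_filter, mem_univ, true_and, Set.mem_ofPred_eq] at h ⊢
      refine ⟨?_, ?_⟩
      · linear_combination c ^ N * h.1
      · linear_combination c * h.2
    · intro p _
      simp [hc]
    · intro p _
      simp [hc]
  have hzero : #{p : F × F | p.1 ^ N + p.2 ^ N + 0 ^ N = 0 ∧ p.1 + p.2 + 0 = 0} =
      Fintype.card F := by
    rw [← Finset.card_univ]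
    refine Finset.card_nbij' (fun p => p.1) (fun a => (a, a)) ?_ ?_ ?_ ?_
    · intro p _
      simp
    · intro a _
      simp [hN, CharTwo.add_self_eq_zero]
    · rintro ⟨a, b⟩ h
      simp only [coe_filter, mem_univ, true_and, Set.mem_ofPred_eq, add_zero] at h
      rw [CharTwo.add_eq_zero.1 h.2]
    · intro a _
      rfl
  have hone : #{p : F × F | p.1 ^ N + p.2 ^ N + 1 = 0 ∧ p.1 + p.2 + 1 = 0} =
      Nat.card {p : F × F | p.1 ≠ 0 ∧ p.2 ≠ 0 ∧ p.1 + p.2 + 1 = 0 ∧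
            p.1 ^ N + p.2 ^ N + 1 = 0} + 2 := by
    have h2 : #({(0, 1), (1, 0)} : Finset (F × F)) = 2 := by
      rw [Finset.card_pair]
      simp
    have h11 : (1 : F) + 1 = 0 := CharTwo.add_self_eq_zero 1
    rw [Nat.card_eq_card_toFinset, ← h2, ← Finset.card_union_of_disjoint]
    · congr 1
      ext ⟨a, b⟩
      by_cases ha : a = 0
      · subst ha
        have : b + 1 = 0 ↔ b = 1 := CharTwo.add_eq_zero
        simp only [mem_filter, mem_univ, zero_add, this, zero_pow hN]
        simp +contextual [h11]
      · by_cases hb : b = 0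
        · subst hb
          have : a + 1 = 0 ↔ a = 1 := CharTwo.add_eq_zero
          simp only [mem_filter, mem_univ, add_zero, this, zero_pow hN]
          simp +contextual [h11]
        · simp [ha, hb, and_comm]
    · rw [Finset.disjoint_left]
      rintro ⟨a, b⟩ h
      simp only [Set.mem_toFinset, Set.mem_ofPred_eq] at h
      simp [h.1, h.2.1]
  have hsum : #{x : F × F × F | x.1 ^ N + x.2.1 ^ N + x.2.2 ^ N = 0 ∧ x.1 + x.2.1 + x.2.2 = 0} =
      ∑ c : F, #{p : F × F | p.1 ^ N + p.2 ^ N + c ^ N = 0 ∧ p.1 + p.2 + c = 0} := by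
    simp only [Finset.card_filter, Fintype.sum_prod_type]
    symm
    rw [Finset.sum_comm]
    exact Finset.sum_congr rfl fun a _ => Finset.sum_comm
  rw [hsum, ← Finset.add_sum_erase _ _ (Finset.mem_univ (0 : F)), hzero,
    Finset.sum_congr rfl fun c hc => hstep c (Finset.ne_of_mem_erase hc), Finset.sum_const,
    Finset.card_erase_of_mem (Finset.mem_univ _), Finset.card_univ, hone, smul_eq_mul]
  push_cast [Nat.cast_sub (Fintype.card_pos (α := F))]
  ring

/-- A sum of a character over a set of vectors stable under scaling is determined by cardinalities. -/
theorem sum_triple_char_mul_card_sub_one [DecidableEq F] {χ : F → ℤ}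
    (hχ0 : χ 0 = 1) (hχ : ∑ x, χ x = 0)
    (P : Finset (F × F × F)) (hP : ∀ c : F, ∀ x ∈ P, (c * x.1, c * x.2.1, c * x.2.2) ∈ P) :
    (∑ x ∈ P, χ (x.1 + x.2.1 + x.2.2)) * (Fintype.card F - 1) =
      Fintype.card F * #{x ∈ P | x.1 + x.2.1 + x.2.2 = 0} - #P := by
  have hscale : ∀ c ∈ (univ : Finset F).erase 0, ∑ x ∈ P, χ (x.1 + x.2.1 + x.2.2) =
      ∑ x ∈ P, χ (c * (x.1 + x.2.1 + x.2.2)) := by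
    intro c hc
    have hc := Finset.ne_of_mem_erase hc
    refine (Finset.sum_nbij' (fun x => (c * x.1, c * x.2.1, c * x.2.2))
      (fun x => (c⁻¹ * x.1, c⁻¹ * x.2.1, c⁻¹ * x.2.2)) (fun x hx => hP c x hx)
      (fun x hx => hP c⁻¹ x hx) ?_ ?_ ?_).symm
    · intro x _
      simp [hc]
    · intro x _
      simp [hc]
    · intro x _
      simp [mul_add]
  have hinner : ∀ s : F, ∑ c ∈ (univ : Finset F).erase 0, χ (c * s) =
      Fintype.card F * (if s = 0 then 1 else 0) - 1 := by
    intro s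
    rw [← Finset.sum_erase_add _ _ (Finset.mem_univ (0 : F))] at hχ
    by_cases hs : s = 0
    · simp [hs, hχ0, Nat.cast_sub (Fintype.card_pos (α := F))]
    · have h1 : ∑ c ∈ (univ : Finset F).erase 0, χ (c * s) =
          ∑ c ∈ (univ : Finset F).erase 0, χ c := by
        refine Finset.sum_nbij' (· * s) (· * s⁻¹) ?_ ?_ ?_ ?_ ?_ <;> simp_all
      rw [h1, if_neg hs]
      linarith
  have h : ∑ c ∈ (univ : Finset F).erase 0, ∑ x ∈ P, χ (x.1 + x.2.1 + x.2.2) =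
      ∑ c ∈ (univ : Finset F).erase 0, ∑ x ∈ P, χ (c * (x.1 + x.2.1 + x.2.2)) :=
    Finset.sum_congr rfl hscale
  rw [Finset.sum_comm (s := univ.erase 0) (t := P)
    (f := fun c x => χ (c * (x.1 + x.2.1 + x.2.2)))] at h
  simp_rw [hinner] at h
  rw [Finset.sum_const, Finset.card_erase_of_mem (Finset.mem_univ _), Finset.card_univ, nsmul_eq_mul,
    Nat.cast_sub (Fintype.card_pos (α := F)), Finset.sum_sub_distrib, ← Finset.mul_sum,
    Finset.sum_boole, Finset.sum_const] at h
  simp only [Nat.cast_one, nsmul_eq_mul, mul_one] at h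
  rw [mul_comm, h]

end

theorem sum_triple_eq_cube {ι : Type*} [Fintype ι] (g : ι → ℤ) :
    ∑ x : ι × ι × ι, g x.1 * g x.2.1 * g x.2.2 = (∑ x, g x) ^ 3 := by
  simp only [Fintype.sum_prod_type, mul_assoc, ← Finset.mul_sum, ← Finset.sum_mul]
  ring

theorem orderOf_eq_card_sub_one [Fintype F] {α : F} (hα0 : α ≠ 0)
    (hα : ∀ x : F, x ≠ 0 → ∃ j : ℕ, α ^ j = x) : orderOf α = Fintype.card F - 1 := by
  rw [← Units.val_mk0 hα0, orderOf_units, ← Nat.card_eq_fintype_card, ← Nat.card_units]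
  refine orderOf_eq_card_of_forall_mem_powers fun x => ?_
  obtain ⟨j, hj⟩ := hα x x.ne_zero
  exact ⟨j, Units.ext (by simpa using hj)⟩

end

/-- third moment identity. Let `m = 2n`, `d > 0` with
`gcd(d, 2^n − 1) = 1`, and let `ν` be the number of ordered pairs
`(x₁, x₂) ∈ F^* × F^*` with `x₁ + x₂ + 1 = 0` and
`x₁^{d(2^n+1)} + x₂^{d(2^n+1)} + 1 = 0`.  Then
`Σ_{τ=0}^{2^n−2} (C_d(τ)+1)³ = −2^{2m} + (ν+3)·2^{n+m}`. -/
theorem crossCorr_third_moment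
    (n m d : ℕ) (hn : 0 < n) (hm : m = 2 * n) (hd : 0 < d)
    (hgcd : Nat.gcd d (2 ^ n - 1) = 1)
    (F : Type) [Field F] [Fintype F] (hF : Fintype.card F = 2 ^ m)
    (α : F) (hα0 : α ≠ 0) (hα : ∀ x : F, x ≠ 0 → ∃ j : ℕ, α ^ j = x) :
    (∑ τ ∈ Finset.range (2 ^ n - 1), (crossCorr m n d α τ + 1) ^ 3)
      = -2 ^ (2 * m) +
        ((Nat.card {p : F × F | p.1 ≠ 0 ∧ p.2 ≠ 0 ∧ p.1 + p.2 + 1 = 0 ∧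
            p.1 ^ (d * (2 ^ n + 1)) + p.2 ^ (d * (2 ^ n + 1)) + 1 = 0} : ℤ) + 3) *
          2 ^ (n + m) := by
  classical
  have hchar : CharP F 2 := charP_of_card_eq_prime_pow hF
  have hm0 : 0 < m := by omega
  set q := 2 ^ n with hq
  have hq1 : 1 < q := Nat.one_lt_two_pow hn.ne'
  have hmq : 2 ^ m = q ^ 2 := by rw [hm, hq, ← pow_mul, mul_comm]
  have hFq : Fintype.card F = q ^ 2 := hF.trans hmq
  have hfrob : ∀ x y : F, (x + y) ^ q = x ^ q + y ^ q := fun x y => add_pow_char_pow x y 2 n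
  set f : F → F := fun x => x ^ (d * (q + 1)) with hf
  have hfpow : ∀ x, f x ^ q = f x := pow_mul_succ_pow hFq d
  set K : Finset F := {x : F | x ^ q = x} with hK
  have hKmem : ∀ x, x ∈ K ↔ x ^ q = x := fun x => by simp [hK]
  have hKcard : K.card = q := card_filter_pow_eq_self hq1 hFq
  have hK0 : (0 : F) ∈ K := by simp [hKmem, hq]
  have hKadd : ∀ x ∈ K, ∀ y ∈ K, x + y ∈ K := fun x hx y hy => by
    rw [hKmem] at *
    rw [hfrob, hx, hy]
  have hKmul : ∀ x ∈ K, ∀ y ∈ K, x * y ∈ K := fun x hx y hy => by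
    rw [hKmem] at *
    rw [mul_pow, hx, hy]
  have hKf : ∀ x, f x ∈ K := fun x => (hKmem _).2 (hfpow x)
  set χ : F → ℤ := fun x => sgnF (trF m x) with hχ
  set ψ : F → ℤ := fun x => sgnF (trF n x) with hψ
  have htm : ∀ x : F, trF m x = 0 ∨ trF m x = 1 := fun x =>
    trF_eq_zero_or_one (by rw [← hF, FiniteField.pow_card])
  have htn : ∀ x ∈ K, trF n x = 0 ∨ trF n x = 1 := fun x hx =>
    trF_eq_zero_or_one ((hKmem x).1 hx)
  have hχadd : ∀ x y, χ (x + y) = χ x * χ y := fun x y => by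
    simp only [hχ]
    rw [trF_add, sgnF_add (htm x) (htm y)]
  have hψadd : ∀ x ∈ K, ∀ y ∈ K, ψ (x + y) = ψ x * ψ y := fun x hx y hy => by
    simp only [hψ]
    rw [trF_add, sgnF_add (htn x hx) (htn y hy)]
  have hχ0 : χ 0 = 1 := by simp only [hχ, trF_zero, sgnF_zero]
  have hψ0 : ψ 0 = 1 := by simp only [hψ, trF_zero, sgnF_zero]
  have hχsum : ∑ x, χ x = 0 :=
    sum_sgnF_trF_eq_zero hm0 univ hF (fun x _ => by rw [← hF, FiniteField.pow_card])
      (fun _ _ _ _ => Finset.mem_univ _)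
  have hψsum : ∑ x ∈ K, ψ x = 0 :=
    sum_sgnF_trF_eq_zero hn K hKcard (fun x hx => (hKmem x).1 hx) hKadd
  have hordα := orderOf_eq_card_sub_one hα0 hα
  have hordγ : orderOf (f α) = K.card - 1 := by
    simp only [hf]
    rw [orderOf_pow' _ (by positivity), hordα, hFq, sq_sub_one_gcd hq1 hgcd, hKcard]
    refine Nat.div_eq_of_eq_mul_left (by positivity) ?_
    zify [Nat.one_le_pow 2 q (by omega), hq1.le]
    ring
  have hγpow : ∀ τ : ℕ, f α ^ τ ∈ K := fun τ => by
    rw [hKmem, pow_right_comm, hfpow]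
  have hcorr : ∀ τ, crossCorr m n d α τ + 1 = ∑ x, χ x * ψ (f α ^ τ * f x) := by
    intro τ
    have hsum := sum_range_orderOf_pow_mul (K := (univ : Finset F)) (γ := α) (z := 1)
      (Finset.mem_univ _) (fun _ _ _ _ => Finset.mem_univ _) (Finset.mem_univ _)
      (Finset.mem_univ _) one_ne_zero hα0 hordα (fun x => χ x * ψ (f α ^ τ * f x))
    rw [← Finset.sum_erase_add _ _ (Finset.mem_univ (0 : F)), ← hsum, Finset.card_univ, hF]
    have hf0 : f 0 = 0 := by simp [hf, hd.ne']
    rw [hf0, mul_zero, hχ0, hψ0, mul_one, crossCorr]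
    congr 1
    refine Finset.sum_congr rfl fun t _ => ?_
    have he : (α ^ (2 ^ n + 1)) ^ (d * (t + τ)) = f α ^ τ * f (α ^ t) := by
      simp only [hf, ← hq, ← pow_mul, ← pow_add]
      congr 1
      ring
    rw [mul_one, he, sgnF_add (htm _) (htn _ (hKmul _ (hγpow τ) _ (hKf _)))]
  have horth : ∀ z ∈ K, ∑ τ ∈ range (q - 1), ψ (f α ^ τ * z) =
      q * (if z = 0 then 1 else 0) - 1 := by
    intro z hz
    by_cases hz0 : z = 0
    · simp [hz0, hψ0, Nat.cast_sub hq1.le]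
    · have hsum := sum_range_orderOf_pow_mul hK0 hKmul (hKf α) hz hz0 (pow_ne_zero _ hα0) hordγ ψ
      rw [hKcard] at hsum
      rw [hsum, if_neg hz0]
      rw [← Finset.sum_erase_add _ _ hK0, hψ0] at hψsum
      linarith
  set P : Finset (F × F × F) := {x : F × F × F | f x.1 + f x.2.1 + f x.2.2 = 0} with hP
  have hcube : ∑ τ ∈ range (q - 1), (crossCorr m n d α τ + 1) ^ 3 =
      q * ∑ x ∈ P, χ (x.1 + x.2.1 + x.2.2) := by
    have hterm : ∀ τ, (crossCorr m n d α τ + 1) ^ 3 = ∑ x : F × F × F,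
        χ (x.1 + x.2.1 + x.2.2) * ψ (f α ^ τ * (f x.1 + f x.2.1 + f x.2.2)) := by
      intro τ
      rw [hcorr, ← sum_triple_eq_cube]
      refine Finset.sum_congr rfl fun x _ => ?_
      have hmem : ∀ y, f α ^ τ * f y ∈ K := fun y => hKmul _ (hγpow τ) _ (hKf y)
      rw [hχadd, hχadd, mul_add, mul_add, hψadd _ (hKadd _ (hmem _) _ (hmem _)) _ (hmem _),
        hψadd _ (hmem _) _ (hmem _)]
      ring
    have hχcube : ∑ x : F × F × F, χ (x.1 + x.2.1 + x.2.2) = 0 := by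
      simp only [hχadd]
      rw [sum_triple_eq_cube, hχsum]
      norm_num
    simp_rw [hterm]
    rw [Finset.sum_comm]
    simp_rw [← Finset.mul_sum, horth _ (hKadd _ (hKadd _ (hKf _) _ (hKf _)) _ (hKf _)), mul_sub,
      Finset.sum_sub_distrib, mul_one, hχcube, sub_zero]
    rw [hP, Finset.sum_filter, Finset.mul_sum]
    refine Finset.sum_congr rfl fun x _ => ?_
    split_ifs <;> ring
  have hscale := sum_triple_char_mul_card_sub_one hχ0 hχsum P (by
    intro c x hx
    simp only [hP, Finset.mem_filter, Finset.mem_univ, true_and, hf, mul_pow] at hx ⊢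
    linear_combination c ^ (d * (q + 1)) * hx)
  have hPcard := card_pow_triple_sum_eq_zero hq1 hd.ne' hgcd hFq hfrob
  have hpairs := card_pow_pair_sum_eq_zero (F := F) (N := d * (q + 1)) (by positivity)
  rw [hP, Finset.filter_filter, ← hP, hpairs, hPcard, hFq] at hscale
  have hq2 : (q : ℤ) ^ 2 - 1 ≠ 0 := by
    have : (1 : ℤ) < q := by exact_mod_cast hq1
    nlinarith
  have hqm : (2 : ℤ) ^ (2 * m) = q ^ 4 := by
    rw [hm, hq]
    push_cast
    ring
  have hqnm : (2 : ℤ) ^ (n + m) = q ^ 3 := by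
    rw [hm, hq]
    push_cast
    ring
  rw [hcube, hqm, hqnm]
  refine mul_right_cancel₀ hq2 ?_
  push_cast at hscale
  rw [mul_assoc, hscale]
  ring
end

section
/- Let d be a positive integer such that d·(2^l + 1) ≡ 2^i (mod 2^n − 1) for some nonnegative integer i. Then the number of ordered pairs (x₁, x₂) ∈ F^* × F^* satisfying the system x₁ + x₂ + 1 = 0 and x₁^{d(2^n+1)} + x₂^{d(2^n+1)} + 1 = 0 is exactly 2^k − 2. -/
theorem pow_two_pow_eq_self_of_dvd {M : Type*} [Monoid M] {x : M} {a b : ℕ}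
    (hab : a ∣ b) (hx : x ^ 2 ^ a = x) : x ^ 2 ^ b = x := by
  obtain ⟨c, rfl⟩ := hab
  induction c with
  | zero => simp
  | succ c ih => rw [Nat.mul_succ, pow_add, pow_mul, ih, hx]

theorem pow_sub_one_eq_one_iff {G : Type*} [Group G] {u : G} {N : ℕ} (hN : 0 < N) :
    u ^ (N - 1) = 1 ↔ u ^ N = u := by
  obtain ⟨t, rfl⟩ := Nat.exists_eq_add_of_lt hN
  simp [pow_succ]

theorem pow_two_pow_gcd_eq_self {G : Type*} [Group G] {u : G} {a b : ℕ}
    (ha : u ^ 2 ^ a = u) (hb : u ^ 2 ^ b = u) : u ^ 2 ^ a.gcd b = u := by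
  rw [← pow_sub_one_eq_one_iff (by positivity)] at ha hb ⊢
  rw [← Nat.pow_sub_one_gcd_pow_sub_one]
  exact pow_gcd_eq_one.mpr ⟨ha, hb⟩

theorem pow_eq_pow_of_modEq_two_pow_sub_one {F : Type*} [Field F] {x : F} {n a b : ℕ}
    (hx0 : x ≠ 0) (hx : x ^ 2 ^ n = x) (h : a ≡ b [MOD 2 ^ n - 1]) : x ^ a = x ^ b := by
  refine pow_eq_pow_of_modEq h ?_
  have := (pow_sub_one_eq_one_iff (u := Units.mk0 x hx0) (N := 2 ^ n) (by positivity)).2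
    (Units.ext (by simpa using hx))
  simpa using congrArg Units.val this

/-- If an element and its `2 ^ n`-th power have the same sum and product as `a` and `b`, both fixed
by the `2 ^ n`-power map, then all of them coincide. -/
theorem eq_of_add_pow_eq_of_mul_pow_eq {F : Type*} [Field F] [CharP F 2] {x a b : F} {n : ℕ}
    (ha : a ^ 2 ^ n = a) (hb : b ^ 2 ^ n = b)
    (hadd : x + x ^ 2 ^ n = a + b) (hmul : x * x ^ 2 ^ n = a * b) : x = a ∧ b = a := by
  have hroot : (x - a) * (x - b) = 0 := by linear_combination x * hadd - hmul
  have hfix : x ^ 2 ^ n = x := by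
    rcases mul_eq_zero.mp hroot with h | h
    · rw [sub_eq_zero.mp h, ha]
    · rw [sub_eq_zero.mp h, hb]
  rw [hfix, CharTwo.add_self_eq_zero] at hadd
  have hba : b = a := by rw [← CharTwo.add_eq_zero, add_comm, ← hadd]
  subst hba
  rw [hfix] at hmul
  exact ⟨CharTwo.sq_injective (by simpa [sq] using hmul), rfl⟩

theorem pow_add_add_one_pow_add_one_eq_zero_iff {F : Type*} [Field F] [CharP F 2] {k n l d i : ℕ}
    (hkn : k ∣ n) (hkl : k ∣ l) (hgcd : n.gcd l = k) (hF : ∀ x : F, x ^ 2 ^ (2 * n) = x)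
    (hdi : d * (2 ^ l + 1) ≡ 2 ^ i [MOD 2 ^ n - 1]) {x : F} (hx0 : x ≠ 0) (hx1 : x + 1 ≠ 0) :
    x ^ (d * (2 ^ n + 1)) + (x + 1) ^ (d * (2 ^ n + 1)) + 1 = 0 ↔ x ^ 2 ^ k = x := by
  have fixed (y : F) : (y ^ (2 ^ n + 1)) ^ 2 ^ n = y ^ (2 ^ n + 1) := by
    rw [← pow_mul, add_mul, pow_add, ← pow_add 2 n n, ← two_mul, hF]; ring
  have frob (y z : F) (j : ℕ) : (y + z) ^ 2 ^ j = y ^ 2 ^ j + z ^ 2 ^ j :=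
    add_pow_char_pow y z 2 j
  constructor
  · intro h
    have key (y : F) (hy : y ≠ 0) :
        (y ^ (d * (2 ^ n + 1))) ^ (2 ^ l + 1) = (y ^ 2 ^ i) ^ (2 ^ n + 1) := by
      have := pow_eq_pow_of_modEq_two_pow_sub_one (pow_ne_zero _ hy) (fixed y) hdi
      calc _ = (y ^ (2 ^ n + 1)) ^ (d * (2 ^ l + 1)) := by ring
        _ = _ := by rw [this]; ring
    have hA := key x hx0
    have hB := key _ hx1
    have hAfix : (x ^ (d * (2 ^ n + 1))) ^ 2 ^ n = x ^ (d * (2 ^ n + 1)) := by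
      rw [mul_comm d, pow_mul x, pow_right_comm, fixed]
    set A := x ^ (d * (2 ^ n + 1))
    set X := x ^ 2 ^ i with hX
    have hBA : (x + 1) ^ (d * (2 ^ n + 1)) = A + 1 := by
      rw [← CharTwo.add_eq_zero, ← h]; ring
    rw [hBA, frob x, one_pow, ← hX, pow_succ, pow_succ, frob, frob, one_pow, one_pow] at hB
    rw [pow_succ, pow_succ] at hA
    obtain ⟨hXA, hAl⟩ := eq_of_add_pow_eq_of_mul_pow_eq (x := X) (b := A ^ 2 ^ l) hAfix
      (by rw [pow_right_comm, hAfix]) (by linear_combination hA - hB) (by linear_combination -hA)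
    have hA0 : A ≠ 0 := pow_ne_zero _ hx0
    have := pow_two_pow_gcd_eq_self (u := Units.mk0 A hA0) (a := n) (b := l)
      (Units.ext (by simpa using hAfix)) (Units.ext (by simpa using hAl))
    rw [hgcd] at this
    have hXk : X ^ 2 ^ k = X := by simpa [hXA] using congrArg Units.val this
    refine iterateFrobenius_inj F 2 i ?_
    rw [iterateFrobenius_def, iterateFrobenius_def, pow_right_comm]
    exact hXk
  · intro h
    have key (y : F) (hy : y ≠ 0) (h : y ^ 2 ^ k = y) : y ^ (d * (2 ^ n + 1)) = y ^ 2 ^ i := by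
      have hn := pow_two_pow_eq_self_of_dvd hkn h
      rw [← pow_eq_pow_of_modEq_two_pow_sub_one hy hn hdi, mul_comm, mul_comm d, pow_mul, pow_mul,
        pow_succ, pow_succ, hn, pow_two_pow_eq_self_of_dvd hkl h]
    rw [key x hx0 h, key _ hx1 (by rw [frob, h, one_pow]), frob, one_pow]
    linear_combination CharTwo.add_self_eq_zero (x ^ 2 ^ i) + CharTwo.add_self_eq_zero (1 : F)

/-- With the standing notation (`n = kr`, `m = 2n`, `l = ks`, …), let
`d > 0` satisfy `d·(2^l + 1) ≡ 2^i (mod 2^n − 1)` for some `i ≥ 0`.  Then the number of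
ordered pairs `(x₁, x₂) ∈ F^* × F^*` satisfying `x₁ + x₂ + 1 = 0` and
`x₁^{d(2^n+1)} + x₂^{d(2^n+1)} + 1 = 0` is exactly `2^k − 2`. -/
theorem card_pairs_eq
    (k r s n m l : ℕ) (hk : 1 ≤ k) (hr : 3 ≤ r) (hro : Odd r)
    (hn : n = k * r) (hm : m = 2 * n) (hl : l = k * s)
    (hse : Even s) (hs0 : 0 < s) (hsr : s < r) (hrs : Nat.gcd r s = 1)
    (F : Type) [Field F] [Fintype F] (hF : Fintype.card F = 2 ^ m)
    (d i : ℕ) (hd : 0 < d)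
    (hdi : d * (2 ^ l + 1) ≡ 2 ^ i [MOD 2 ^ n - 1]) :
    Nat.card {p : F × F | p.1 ≠ 0 ∧ p.2 ≠ 0 ∧ p.1 + p.2 + 1 = 0 ∧
        p.1 ^ (d * (2 ^ n + 1)) + p.2 ^ (d * (2 ^ n + 1)) + 1 = 0}
      = 2 ^ k - 2 := by
  have hchar : CharP F 2 := charP_of_card_eq_prime_pow hF
  have hgcd : n.gcd l = k := by rw [hn, hl, Nat.gcd_mul_left, hrs, mul_one]
  have hpow (x : F) : x ^ 2 ^ (2 * n) = x := by rw [← hm, ← hF, FiniteField.pow_card]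
  have himage : {p : F × F | p.1 ≠ 0 ∧ p.2 ≠ 0 ∧ p.1 + p.2 + 1 = 0 ∧
        p.1 ^ (d * (2 ^ n + 1)) + p.2 ^ (d * (2 ^ n + 1)) + 1 = 0}
      = (fun u : Fˣ => ((u : F), (u : F) + 1)) '' ({u | u ^ (2 ^ k - 1) = 1} \ {1}) := by
    have hiff {x : F} (hx0 : x ≠ 0) (hx1 : x + 1 ≠ 0) :=
      pow_add_add_one_pow_add_one_eq_zero_iff ⟨r, hn⟩ ⟨s, hl⟩ hgcd hpow hdi hx0 hx1
    ext ⟨x, y⟩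
    simp only [Set.mem_ofPred_eq, Set.mem_image, Set.mem_sdiff, Set.mem_singleton_iff,
      pow_sub_one_eq_one_iff (Nat.two_pow_pos k), Prod.mk.injEq]
    constructor
    · rintro ⟨hx, hy, hxy, h⟩
      obtain rfl : y = x + 1 := by rw [← CharTwo.add_eq_zero, ← hxy]; ring
      refine ⟨Units.mk0 x hx, ⟨Units.ext (by simpa using (hiff hx hy).1 h), ?_⟩, rfl, rfl⟩
      intro h1
      exact hy (CharTwo.add_eq_zero.2 (by simpa using congrArg Units.val h1))
    · rintro ⟨u, ⟨hu, hu1⟩, rfl, rfl⟩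
      have hne : (u : F) + 1 ≠ 0 := fun h => hu1 (Units.ext (CharTwo.add_eq_zero.1 h))
      refine ⟨u.ne_zero, hne, ?_, (hiff u.ne_zero hne).2 (by simpa using congrArg Units.val hu)⟩
      rw [← add_assoc, CharTwo.add_self_eq_zero, zero_add, CharTwo.add_self_eq_zero]
  have hdvd : 2 ^ k - 1 ∣ Nat.card Fˣ := by
    rw [Nat.card_units, Nat.card_eq_fintype_card, hF, hm, hn, mul_left_comm]
    exact Nat.pow_sub_one_dvd_pow_sub_one 2 (dvd_mul_right k _)
  have hroots : {u : Fˣ | u ^ (2 ^ k - 1) = 1}.ncard = 2 ^ k - 1 :=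
    (IsCyclic.card_powMonoidHom_ker (G := Fˣ) (2 ^ k - 1)).trans (Nat.gcd_eq_right hdvd)
  rw [himage, Nat.card_coe_set_eq, Set.ncard_image_of_injective _ fun u v h =>
    Units.ext (congrArg Prod.fst h), Set.ncard_sdiff_singleton_of_mem (by simp), hroots]
  rfl
end
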